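/- Let g be a finite-dimensional simple Lie algebra over an algebraically closed field K of characteristic 0 and let φ : g → g be a local automorphism. Then there exists a Lie algebra automorphism β of g such that φ = β or φ = −β. -/

import Mathlib

/-- A linear map `φ : L → L` is a *local automorphism* of the Lie algebra `L` if for
every `x ∈ L` there exists a Lie algebra automorphism `e` of `L` with `φ x = e x`. -/
def IsLocalAutomorphism (K L : Type*) [Field K] [LieRing L] [LieAlgebra K L]
    (φ : L →ₗ[K] L) : Prop :=
  ∀ x : L, ∃ e : L ≃ₗ⁅K⁆ L, φ x = e x

section Trace

open Module

variable {K V : Type*} [Field K] [AddCommGroup V] [Module K V]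

open Polynomial in
lemma Polynomial.coeff_zero_C_add_C_mul_X_pow {R : Type*} [Semiring R] (a b : R) (n : ℕ) :
    ((C a + C b * X) ^ n).coeff 0 = a ^ n := by
  induction n with
  | zero => simp
  | succ n ih => simp [pow_succ, mul_coeff_zero, ih]

open Polynomial in
lemma LinearMap.trace_mul_coeff_one_C_add_C_mul_X_pow (A B : End K V) (m n : ℕ) :
    trace K V (A ^ m * ((C A + C B * X) ^ (n + 1)).coeff 1) =
      (n + 1) * trace K V (A ^ (m + n) * B) := by
  induction n generalizing m with
  | zero => simp
  | succ n ih =>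
    rw [pow_succ, mul_coeff_one, coeff_zero_C_add_C_mul_X_pow, mul_add, map_add, ← mul_assoc,
      ← pow_add]
    have : trace K V (A ^ m * (((C A + C B * X) ^ (n + 1)).coeff 1 * (C A + C B * X).coeff 0)) =
        (n + 1) * trace K V (A ^ (m + (n + 1)) * B) := by
      rw [← mul_assoc, trace_mul_comm, ← mul_assoc]
      simp [← pow_succ', ih, add_right_comm, add_assoc]
    rw [this]
    simp
    ring

open Polynomial in
/-- The trace of the powers of a linear pencil determines its first order terms. -/
lemma LinearMap.trace_pow_mul_eq_of_trace_add_smul_pow_eq [CharZero K] {A B A' B' : End K V}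
    {n : ℕ} (h : ∀ t : K, trace K V ((A + t • B) ^ (n + 1)) = trace K V ((A' + t • B') ^ (n + 1))) :
    trace K V (A ^ n * B) = trace K V (A' ^ n * B') := by
  let τ (Q : (End K V)[X]) : K[X] := Q.sum fun i a ↦ monomial i (trace K V a)
  have τ_coeff (Q : (End K V)[X]) (i : ℕ) : (τ Q).coeff i = trace K V (Q.coeff i) := by
    simp only [τ, Polynomial.sum_def, finsetSum_coeff, coeff_monomial]
    by_cases hi : i ∈ Q.support
    · simp [hi]
    · simp [hi, notMem_support_iff.1 hi]
  have τ_eval (A B : End K V) (t : K) (n : ℕ) :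
      (τ ((C A + C B * X) ^ n)).eval t = trace K V ((A + t • B) ^ n) := by
    have hc (a : End K V) : Commute (RingHom.id _ a) (algebraMap K (End K V) t) :=
      (Algebra.commutes t a).symm
    have hpow : (A + t • B) ^ n =
        eval₂RingHom' (RingHom.id _) (algebraMap K (End K V) t) hc ((C A + C B * X) ^ n) := by
      rw [map_pow]
      congr 1
      simp [eval₂RingHom', Algebra.smul_def, Algebra.commutes t B]
    rw [hpow]
    simp only [eval₂RingHom', RingHom.coe_mk, MonoidHom.coe_mk, OneHom.coe_mk, eval₂_eq_sum,
      τ, Polynomial.sum_def, eval_finsetSum, eval_monomial, map_sum, RingHom.id_apply]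
    refine Finset.sum_congr rfl fun i _ ↦ ?_
    rw [← map_pow, ← Algebra.commutes, ← Algebra.smul_def, map_smul, smul_eq_mul, mul_comm]
  have hτ : τ ((C A + C B * X) ^ (n + 1)) = τ ((C A' + C B' * X) ^ (n + 1)) :=
    Polynomial.funext fun t ↦ by rw [τ_eval, τ_eval, h]
  have h1 := congrArg (coeff · 1) hτ
  have h2 := trace_mul_coeff_one_C_add_C_mul_X_pow A B 0 n
  have h3 := trace_mul_coeff_one_C_add_C_mul_X_pow A' B' 0 n
  simp only [τ_coeff] at h1
  simp only [pow_zero, one_mul, zero_add, h1] at h2 h3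
  exact mul_left_cancel₀ (Nat.cast_add_one_ne_zero n) (h2.symm.trans h3)

end Trace

namespace LieAlgebra

section Triple

open Module

variable {K L : Type*} [Field K] [LieRing L] [LieAlgebra K L]

lemma lie_lie_of_lie_self_lie [CharZero K] {φ : L →ₗ[K] L}
    (h : ∀ x y, φ ⁅x, ⁅x, y⁆⁆ = ⁅φ x, ⁅φ x, φ y⁆⁆) (x y z : L) :
    φ ⁅x, ⁅y, z⁆⁆ = ⁅φ x, ⁅φ y, φ z⁆⁆ := by
  have pol (x y z : L) : φ ⁅x, ⁅y, z⁆⁆ + φ ⁅y, ⁅x, z⁆⁆ =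
      ⁅φ x, ⁅φ y, φ z⁆⁆ + ⁅φ y, ⁅φ x, φ z⁆⁆ := by
    have := h (x + y) z
    simp only [add_lie, lie_add, map_add, h] at this
    linear_combination (norm := module) (1 : K) • this
  have jac (x y z : L) : ⁅z, ⁅x, y⁆⁆ = -⁅x, ⁅y, z⁆⁆ + ⁅y, ⁅x, z⁆⁆ := by
    rw [leibniz_lie z x y, ← lie_skew z y, ← lie_skew z x, ← lie_skew y ⁅x, z⁆]
    simp only [lie_neg, neg_lie]
    abel
  have h₁ := pol x y z
  have h₂ := pol x z y
  rw [← lie_skew z y, ← lie_skew (φ z) (φ y), jac x y z, jac (φ x) (φ y) (φ z)] at h₂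
  simp only [lie_neg, map_neg, map_add] at h₂
  have : (3 : K) • φ ⁅x, ⁅y, z⁆⁆ = (3 : K) • ⁅φ x, ⁅φ y, φ z⁆⁆ := by
    linear_combination (norm := module) (1 : K) • h₁ - (1 : K) • h₂
  exact smul_right_injective L (three_ne_zero : (3 : K) ≠ 0) this

theorem exists_eq_pm_of_lie_lie [IsAlgClosed K] [FiniteDimensional K L] [IsSimple K L]
    {φ : L →ₗ[K] L} (hφ : Function.Bijective φ)
    (h : ∀ x y z, φ ⁅x, ⁅y, z⁆⁆ = ⁅φ x, ⁅φ y, φ z⁆⁆) :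
    ∃ β : L ≃ₗ⁅K⁆ L, φ = (β : L →ₗ[K] L) ∨ φ = -(β : L →ₗ[K] L) := by
  have faithful (x : L) (hx : ∀ z : L, ⁅x, z⁆ = 0) : x = 0 := by
    have hx' : x ∈ center K L := by
      rw [LieModule.mem_maxTrivSubmodule]
      intro z
      rw [← lie_skew, hx, neg_zero]
    simpa using hx'
  have unique (w w' : L) (hw : ∀ z, ⁅w, φ z⁆ = ⁅w', φ z⁆) : w = w' := by
    rw [← sub_eq_zero]
    refine faithful _ fun z ↦ ?_
    obtain ⟨z, rfl⟩ := hφ.2 z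
    rw [sub_lie, hw, sub_self]
  have bracket (x y z : L) : φ ⁅⁅x, y⁆, z⁆ = ⁅⁅φ x, φ y⁆, φ z⁆ := by
    rw [lie_lie, lie_lie, map_sub, h, h]
  let S : Submodule K L :=
    { carrier := {x | ∃ w : L, ∀ z, φ ⁅x, z⁆ = ⁅w, φ z⁆}
      add_mem' := by
        rintro x y ⟨w, hw⟩ ⟨v, hv⟩
        exact ⟨w + v, fun z ↦ by rw [add_lie, map_add, hw, hv, add_lie]⟩
      zero_mem' := ⟨0, fun z ↦ by simp⟩
      smul_mem' := by
        rintro c x ⟨w, hw⟩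
        exact ⟨c • w, fun z ↦ by rw [smul_lie, map_smul, hw, smul_lie]⟩ }
  have hS (x : L) : x ∈ S := by
    have htop : ⁅(⊤ : LieIdeal K L), (⊤ : LieIdeal K L)⁆ = ⊤ := by
      refine (IsSimple.eq_bot_or_eq_top _).resolve_left fun hbot ↦ ?_
      refine IsSimple.non_abelian (R := K) (L := L) ⟨fun x y ↦ ?_⟩
      have := LieSubmodule.lie_mem_lie (I := (⊤ : LieIdeal K L)) (N := (⊤ : LieIdeal K L))
        (LieSubmodule.mem_top x) (LieSubmodule.mem_top y)
      rwa [hbot, LieSubmodule.mem_bot] at this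
    have hx : x ∈ (⁅(⊤ : LieIdeal K L), (⊤ : LieIdeal K L)⁆ : LieIdeal K L).toSubmodule := by
      rw [htop]; trivial
    rw [LieSubmodule.lieIdeal_oper_eq_linear_span'] at hx
    refine Submodule.span_le.2 ?_ hx
    rintro _ ⟨x, -, y, -, rfl⟩
    exact ⟨⁅φ x, φ y⁆, bracket x y⟩
  choose f hf using hS
  have f_lie (x y : L) : f ⁅x, y⁆ = ⁅f x, f y⁆ := by
    refine unique _ _ fun z ↦ ?_
    rw [← hf, lie_lie, map_sub, hf, hf, hf, hf, lie_lie]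
  have f_lie' (x y : L) : f ⁅x, y⁆ = ⁅φ x, φ y⁆ :=
    unique _ _ fun z ↦ by rw [← hf, bracket]
  let ψ : L →ₗ⁅K⁆ L :=
    { toFun := f
      map_add' := fun x y ↦ unique _ _ fun z ↦ by
        rw [← hf, add_lie, map_add, hf, hf, add_lie]
      map_smul' := fun c x ↦ unique _ _ fun z ↦ by
        rw [← hf, smul_lie, map_smul, hf, RingHom.id_apply, smul_lie]
      map_lie' := fun {x y} ↦ f_lie x y }
  have hψi : Function.Injective ψ := by
    rw [injective_iff_map_eq_zero]
    intro x hx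
    refine faithful x fun z ↦ hφ.1 ?_
    rw [hf, show f x = 0 from hx, zero_lie, map_zero]
  have hψ : Function.Bijective ψ :=
    ⟨hψi, LinearMap.surjective_of_injective (f := (ψ : L →ₗ[K] L)) hψi⟩
  let β : L ≃ₗ⁅K⁆ L := LieEquiv.ofBijective ψ hψ
  have hβ (x : L) : β x = f x := rfl
  have : Nontrivial L := by
    by_contra! hL
    exact IsSimple.non_abelian (R := K) (L := L) ⟨fun _ _ ↦ Subsingleton.elim _ _⟩
  let θ : End K L := (β.symm : L →ₗ[K] L) ∘ₗ φ
  have hfθ (x : L) : f (θ x) = φ x := β.apply_symm_apply (φ x)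
  have hθ (x y : L) : θ ⁅x, y⁆ = ⁅x, θ y⁆ := by
    refine hψi ?_
    change f _ = f _
    rw [hfθ, f_lie, hfθ, hf]
  obtain ⟨c, hc⟩ := End.exists_eigenvalue θ
  let I : LieIdeal K L :=
    { θ.eigenspace c with
      lie_mem := by
        intro x m hm
        have hm : θ m = c • m := by simpa using hm
        change ⁅x, m⁆ ∈ θ.eigenspace c
        rw [End.mem_eigenspace_iff, hθ, hm, lie_smul] }
  have hI : I = ⊤ := by
    refine (IsSimple.eq_bot_or_eq_top _).resolve_left fun hbot ↦ hc ?_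
    have := congrArg LieSubmodule.toSubmodule hbot
    simpa [I] using this
  have hφc (x : L) : φ x = c • f x := by
    have hx : x ∈ I := by rw [hI]; trivial
    have hx : θ x = c • x := End.mem_eigenspace_iff.1 hx
    rw [← hfθ, hx]
    exact map_smul ψ c x
  have hc2 : c ^ 2 = 1 := by
    by_contra hne
    refine IsSimple.non_abelian (R := K) (L := L) ⟨fun x y ↦ hψi ?_⟩
    have h1 : f ⁅x, y⁆ = (c ^ 2) • f ⁅x, y⁆ := by
      conv_lhs => rw [f_lie', hφc, hφc, smul_lie, lie_smul, smul_smul, ← pow_two, ← f_lie]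
    have h2 : (c ^ 2 - 1) • f ⁅x, y⁆ = 0 := by rw [sub_smul, ← h1, one_smul, sub_self]
    rw [map_zero]
    exact (smul_eq_zero.1 h2).resolve_left (sub_ne_zero.2 hne)
  refine ⟨β, (eq_or_eq_neg_of_sq_eq_sq c 1 (by rwa [one_pow])).imp ?_ ?_⟩
  all_goals
    rintro rfl
    ext x
    simp [hφc, hβ]

end Triple

end LieAlgebra

namespace LieAlgebra

section Gradient

variable {K L : Type*} [Field K] [LieRing L] [LieAlgebra K L] [FiniteDimensional K L]
  [IsKilling K L]

open Module Polynomial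

/-- The Killing gradient at `x` of the trace function `x ↦ trace (q (ad x))`, where `q' = p`. -/
noncomputable def adTraceGradient (p : K[X]) (x : L) : L :=
  ((killingForm K L).toDual (IsKilling.killingForm_nondegenerate K L)).symm
    (LinearMap.trace K L ∘ₗ LinearMap.mulLeft K (aeval (ad K L x) p) ∘ₗ
      (ad K L : L →ₗ[K] End K L))

lemma killingForm_adTraceGradient (p : K[X]) (x y : L) :
    killingForm K L (adTraceGradient p x) y =
      LinearMap.trace K L (aeval (ad K L x) p * ad K L y) := by
  rw [← LinearMap.BilinForm.toDual_def (IsKilling.killingForm_nondegenerate K L), adTraceGradient,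
    LinearEquiv.apply_symm_apply]
  rfl

lemma eq_of_forall_killingForm_eq {x y : L}
    (h : ∀ z, killingForm K L x z = killingForm K L y z) : x = y :=
  ((killingForm K L).toDual (IsKilling.killingForm_nondegenerate K L)).injective
    (LinearMap.ext h)

lemma lie_adTraceGradient (p : K[X]) (x : L) : ⁅x, adTraceGradient p x⁆ = 0 := by
  refine eq_of_forall_killingForm_eq (K := K) fun y ↦ ?_
  have hc : Commute (aeval (ad K L x) p) (ad K L x) := by
    simpa using (Commute.all p X).map (aeval (ad K L x))
  have had : ad K L ⁅x, y⁆ = ad K L x * ad K L y - ad K L y * ad K L x :=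
    LinearMap.ext fun z ↦ by simp
  rw [LieModule.traceForm_apply_lie_apply', killingForm_adTraceGradient, had, mul_sub, map_sub,
    map_zero, LinearMap.zero_apply, ← mul_assoc, ← mul_assoc,
    LinearMap.trace_mul_comm K (_ * ad K L y) (ad K L x), ← mul_assoc, hc.eq, sub_self, neg_zero]

end Gradient

end LieAlgebra

namespace IsLocalAutomorphism

open LieAlgebra Polynomial

variable {K L : Type*} [Field K] [LieRing L] [LieAlgebra K L] {φ ψ : L →ₗ[K] L}

lemma of_lieEquiv (e : L ≃ₗ⁅K⁆ L) : IsLocalAutomorphism K L (e : L →ₗ[K] L) :=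
  fun _ ↦ ⟨e, rfl⟩

lemma comp (hφ : IsLocalAutomorphism K L φ) (hψ : IsLocalAutomorphism K L ψ) :
    IsLocalAutomorphism K L (φ ∘ₗ ψ) := fun x ↦ by
  obtain ⟨e, he⟩ := hψ x
  obtain ⟨f, hf⟩ := hφ (e x)
  exact ⟨e.trans f, by simp [he, hf]⟩

lemma injective (hφ : IsLocalAutomorphism K L φ) : Function.Injective φ := by
  rw [injective_iff_map_eq_zero]
  intro x hx
  obtain ⟨e, he⟩ := hφ x
  exact (map_eq_zero_iff e e.injective).1 (he.symm.trans hx)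

lemma bijective [FiniteDimensional K L] (hφ : IsLocalAutomorphism K L φ) : Function.Bijective φ :=
  ⟨hφ.injective, LinearMap.surjective_of_injective hφ.injective⟩

lemma trace_ad_pow (hφ : IsLocalAutomorphism K L φ) (n : ℕ) (x : L) :
    LinearMap.trace K L (ad K L (φ x) ^ n) = LinearMap.trace K L (ad K L x ^ n) := by
  obtain ⟨e, he⟩ := hφ x
  have h : ad K L (e x) ^ n = e.toLinearEquiv.conj (ad K L x ^ n) := by
    rw [← conj_ad_apply]
    exact (map_pow (LinearEquiv.conjRingEquiv e.toLinearEquiv) (ad K L x) n).symm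
  rw [he, h, LinearMap.trace_conj']

variable [CharZero K]

lemma trace_aeval_ad_mul_ad (hφ : IsLocalAutomorphism K L φ) (p : K[X]) (x y : L) :
    LinearMap.trace K L (aeval (ad K L (φ x)) p * ad K L (φ y)) =
      LinearMap.trace K L (aeval (ad K L x) p * ad K L y) := by
  have h (n : ℕ) : LinearMap.trace K L (ad K L (φ x) ^ n * ad K L (φ y)) =
      LinearMap.trace K L (ad K L x ^ n * ad K L y) :=
    LinearMap.trace_pow_mul_eq_of_trace_add_smul_pow_eq fun t ↦ by
      simpa using hφ.trace_ad_pow (n + 1) (x + t • y)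
  induction p using Polynomial.induction_on' with
  | add p q hp hq => simp only [map_add, add_mul, hp, hq]
  | monomial n a => simp only [aeval_monomial, ← Algebra.smul_def, smul_mul_assoc, map_smul, h]

lemma killingForm_apply [FiniteDimensional K L] (hφ : IsLocalAutomorphism K L φ) (x y : L) :
    killingForm K L (φ x) (φ y) = killingForm K L x y := by
  simpa [killingForm_apply_apply, Module.End.mul_eq_comp] using hφ.trace_aeval_ad_mul_ad X x y

variable [FiniteDimensional K L] [IsKilling K L]

lemma map_adTraceGradient (hφ : IsLocalAutomorphism K L φ) (p : K[X]) (x : L) :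
    φ (adTraceGradient p x) = adTraceGradient p (φ x) := by
  refine eq_of_forall_killingForm_eq (K := K) fun y ↦ ?_
  obtain ⟨y, rfl⟩ := hφ.bijective.2 y
  rw [hφ.killingForm_apply, killingForm_adTraceGradient, killingForm_adTraceGradient,
    hφ.trace_aeval_ad_mul_ad]

end IsLocalAutomorphism

namespace LieAlgebra

open Polynomial in
lemma aeval_ad_apply {K L : Type*} [Field K] [LieRing L] [LieAlgebra K L] {x y : L} {a : K}
    (h : ⁅x, y⁆ = a • y) (p : K[X]) :
    aeval (ad K L x) p y = p.eval a • y := by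
  by_cases hy : y = 0
  · simp [hy]
  · exact Module.End.aeval_apply_of_hasEigenvector ⟨Module.End.mem_eigenspace_iff.2 h, hy⟩

namespace IsKilling

open Module Polynomial LieModule

variable {K L : Type*} [Field K] [CharZero K] [LieRing L] [LieAlgebra K L] [FiniteDimensional K L]
  [IsKilling K L] {H : LieSubalgebra K L} [H.IsCartanSubalgebra] [IsTriangularizable K H L]

lemma exists_forall_weight_ne (K L : Type*) [Field K] [CharZero K] [LieRing L] [LieAlgebra K L]
    [FiniteDimensional K L] [IsKilling K L] (H : LieSubalgebra K L) [H.IsCartanSubalgebra]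
    [IsTriangularizable K H L] :
    ∃ x : H, (Function.Injective fun α : Weight K H L ↦ α x) ∧
      ∀ α : Weight K H L, α.IsNonZero → α x ≠ 0 := by
  obtain ⟨x, hx⟩ := Module.Dual.exists_forall_ne_zero_of_forall_exists
    (ι := {αβ : Weight K H L × Weight K H L // αβ.1 ≠ αβ.2} ⊕ {α : Weight K H L // α.IsNonZero})
    (Sum.elim (fun i ↦ Weight.toLinear K H L i.1.1 - Weight.toLinear K H L i.1.2)
      fun i ↦ Weight.toLinear K H L i.1) <| by
    rintro (⟨⟨α, β⟩, h⟩ | ⟨α, h⟩)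
    · by_contra! hc
      exact h (Weight.ext fun z ↦ sub_eq_zero.1 (hc z))
    · by_contra! hc
      exact h (funext hc)
  refine ⟨x, fun α β h ↦ ?_, fun α h ↦ hx (.inr ⟨α, h⟩)⟩
  by_contra hne
  exact hx (.inl ⟨(α, β), hne⟩) (sub_eq_zero.2 h)

lemma exists_adTraceGradient_eq {x : H} (hx : Function.Injective fun α : Weight K H L ↦ α x)
    (z : H) : ∃ p : K[X], adTraceGradient p (x : L) = z := by
  classical
  refine ⟨Lagrange.interpolate Finset.univ (fun α : Weight K H L ↦ α x) fun α ↦ α z,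
    eq_of_forall_killingForm_eq (K := K) fun y ↦ ?_⟩
  set p := Lagrange.interpolate Finset.univ (fun α : Weight K H L ↦ α x) fun α ↦ α z with hp
  suffices h : aeval (ad K L x) p = ad K L z by
    rw [killingForm_adTraceGradient, h, killingForm_apply_apply, Module.End.mul_eq_comp]
  ext y
  have hy : y ∈ ⨆ α : Weight K H L, (rootSpace H α).toSubmodule := by
    rw [LieSubmodule.iSup_toSubmodule_eq_top.2 (iSup_genWeightSpace_eq_top' K H L)]
    trivial
  induction hy using Submodule.iSup_induction' with
  | mem α y hy =>
    rw [aeval_ad_apply (lie_eq_smul_of_mem_rootSpace hy x),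
      Lagrange.eval_interpolate_at_node _ hx.injOn (Finset.mem_univ α)]
    exact (lie_eq_smul_of_mem_rootSpace hy z).symm
  | zero => simp
  | add y z _ _ hy hz => rw [map_add, map_add, hy, hz]

lemma exists_lieEquiv_coe_eq_sub {α : Weight K H L} (hα : α.IsNonZero) {y : L}
    (hy : y ∈ rootSpace H α) : ∃ e : L ≃ₗ⁅K⁆ L, ∀ h : H, e h = h - α h • y := by
  let : Module ℚ L := Module.compHom L (algebraMap ℚ K)
  let : LieAlgebra ℚ L := { lie_smul := fun q x y ↦ lie_smul (algebraMap ℚ K q) x y }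
  have had : (LieDerivation.ad K L y : L →ₗ[K] L) = ad K L y := LinearMap.ext fun z ↦ by simp
  have hn : _root_.IsNilpotent (LieDerivation.ad K L y : L →ₗ[K] L) := by
    rw [had]
    exact isNilpotent_ad_of_mem_rootSpace H hα hy
  have hlie (h : H) : ⁅y, (h : L)⁆ = -(α h • y) := by
    rw [← lie_skew, ← lie_eq_smul_of_mem_rootSpace hy h]
    rfl
  refine ⟨(LieDerivation.ad K L y).exp hn, fun h ↦ ?_⟩
  rw [LieDerivation.exp_map_apply, ← Module.End.smul_def,
    IsNilpotent.exp_smul_eq_sum (k := 2) (by simp [had, sq, hlie]) hn]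
  simp [Finset.sum_range_succ, had, hlie, sub_eq_add_neg]

lemma lie_lie_eq_smul_of_forall_smul_lie_eq {x : H}
    (hx : ∀ α : Weight K H L, α.IsNonZero → α x ≠ 0)
    {α : Weight K H L} (hα : α.IsNonZero) {w : L} (h₀ : ∀ z : H, killingForm K L w z = 0)
    (h : ∀ z : H, α z • ⁅x, w⁆ = α x • ⁅z, w⁆) (z : H) : ⁅z, ⁅z, w⁆⁆ = (α z * α z) • w := by
  have hw : w ∈ ⨆ α : Weight K H L, (rootSpace H α).toSubmodule := by
    rw [LieSubmodule.iSup_toSubmodule_eq_top.2 (iSup_genWeightSpace_eq_top' K H L)]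
    trivial
  obtain ⟨f, hf, rfl⟩ := (Submodule.mem_iSup_iff_exists_finsupp _ _).1 hw
  have hlie (z : H) (β : Weight K H L) : ⁅z, f β⁆ = β z • f β :=
    lie_eq_smul_of_mem_rootSpace (hf β) z
  have hind := iSupIndep_iff_finsetSum_eq_zero_imp_eq_zero _ |>.1
    (LieSubmodule.iSupIndep_toSubmodule.2 (iSupIndep_genWeightSpace' K H L))
  have key (z : H) (β : Weight K H L) (hβ : β ∈ f.support) : α z * β x = α x * β z := by
    have := hind f.support (fun β ↦ (α z * β x - α x * β z) • f β)
      (fun i _ ↦ Submodule.smul_mem _ _ (hf i)) (by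
        have := h z
        simp only [Finsupp.sum, lie_sum, hlie, Finset.smul_sum, smul_smul] at this
        simp only [sub_smul, Finset.sum_sub_distrib, this, sub_self]) β hβ
    exact sub_eq_zero.1 ((smul_eq_zero.1 this).resolve_right (Finsupp.mem_support_iff.1 hβ))
  have hzero (β : Weight K H L) (hβ : β.IsZero) : f β = 0 := by
    refine eq_of_forall_killingForm_eq (K := K) fun y ↦ ?_
    have hy : y ∈ ⨆ α : Weight K H L, (rootSpace H α).toSubmodule := by
      rw [LieSubmodule.iSup_toSubmodule_eq_top.2 (iSup_genWeightSpace_eq_top' K H L)]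
      trivial
    rw [map_zero, LinearMap.zero_apply]
    induction hy using Submodule.iSup_induction' with
    | mem γ y hy =>
      by_cases hγ : γ.IsZero
      · rw [hγ.eq, rootSpace_zero_eq] at hy
        have hsum := h₀ ⟨y, hy⟩
        rw [Finsupp.sum, map_sum, LinearMap.sum_apply] at hsum
        rwa [Finset.sum_eq_single β] at hsum
        · refine fun δ _ hδ ↦ killingForm_apply_eq_zero_of_mem_rootSpace_of_add_ne_zero K L H
            (β := 0) (hf δ) (by rwa [rootSpace_zero_eq]) fun h ↦ hδ (DFunLike.coe_injective ?_)
          rw [hβ.eq, ← h, add_zero]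
        · intro h
          rw [Finsupp.notMem_support_iff.1 h, map_zero, LinearMap.zero_apply]
      · refine killingForm_apply_eq_zero_of_mem_rootSpace_of_add_ne_zero K L H (hf β) hy ?_
        rwa [hβ.eq, zero_add]
    | zero => simp
    | add y z _ _ hy hz => rw [map_add, hy, hz, add_zero]
  simp only [Finsupp.sum, lie_sum, Finset.smul_sum, hlie, lie_smul, smul_smul]
  refine Finset.sum_congr rfl fun β hβ ↦ ?_
  have hβ0 : β.IsNonZero := fun h ↦ Finsupp.mem_support_iff.1 hβ (hzero β h)
  rcases eq_neg_or_eq_of_eq_smul α β hβ0 (β x / α x) (funext fun z ↦ by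
    have := hx α hα
    simp only [Pi.smul_apply, smul_eq_mul]
    field_simp
    linear_combination -key z β hβ) with rfl | rfl
  · simp
  · rfl

end IsKilling

end LieAlgebra

namespace LieAlgebra

variable {K L : Type*} [Field K] [LieRing L] [LieAlgebra K L] [FiniteDimensional K L]

lemma IsRegular.finite_setOf_not_add_smul {x : L} (hx : IsRegular K x) (y : L) :
    {t : K | ¬ IsRegular K (x + t • y)}.Finite := by
  classical
  let b := Module.finBasis K L
  set Q := ((ad K L : L →ₗ[K] Module.End K L).polyCharpoly b).coeff (rank K L)
  set P : Polynomial K := MvPolynomial.aeval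
    (fun i ↦ Polynomial.C (b.repr x i) + Polynomial.C (b.repr y i) * Polynomial.X) Q with hP
  have heval (t : K) : P.eval t = MvPolynomial.eval (b.repr (x + t • y)) Q := by
    rw [hP, MvPolynomial.aeval_def, MvPolynomial.polynomial_eval_eval₂, ← MvPolynomial.eval₂_id]
    congr 1
    · ext r
      simp
    · ext i
      simp [mul_comm t]
  have hreg (t : K) : IsRegular K (x + t • y) ↔ P.eval t ≠ 0 := by
    rw [heval, isRegular_iff_coeff_polyCharpoly_rank_ne_zero K b]
  have hP0 : P ≠ 0 := by
    rintro h
    exact (hreg 0).1 (by simpa using hx) (by simp [h])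
  refine (Polynomial.finite_setOfPred_isRoot hP0).subset fun t ht ↦ ?_
  rw [Set.mem_ofPred_eq, hreg, not_not] at ht
  exact ht

variable [Infinite K]

lemma IsRegular.isCartanSubalgebra_engel {x : L} (hx : IsRegular K x) :
    (LieSubalgebra.engel K x).IsCartanSubalgebra := by
  refine ⟨LieSubalgebra.isNilpotent_of_forall_le_engel _ fun y hy ↦ ?_,
    LieSubalgebra.normalizer_engel _ _⟩
  have hcard : Module.finrank K L ≤ Cardinal.mk K :=
    Cardinal.natCast_le_aleph0.trans (Cardinal.infinite_iff.1 ‹_›)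
  set E : {LieSubalgebra.engel K z | z ∈ LieSubalgebra.engel K x} :=
    ⟨LieSubalgebra.engel K x, x, LieSubalgebra.self_mem_engel _ _, rfl⟩
  suffices h : IsBot E from @h ⟨LieSubalgebra.engel K y, y, hy, rfl⟩
  refine engel_isBot_of_isMin hcard (LieSubalgebra.engel K x) E le_rfl ?_
  rintro ⟨_, z, hz, rfl⟩ hzx
  have hle : LieSubalgebra.engel K z ≤ LieSubalgebra.engel K x := hzx
  refine (LieSubalgebra.toSubmodule_injective (Submodule.eq_of_le_of_finrank_le hle ?_)).ge
  exact ((isRegular_iff_finrank_engel_eq_rank K x).1 hx).trans_le (rank_le_finrank_engel K z)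

/-- A quadratic map vanishing on the regular elements of a Lie algebra vanishes identically. -/
lemma apply_self_eq_zero_of_forall_isRegular {M : Type*} [AddCommGroup M] [Module K M]
    (B : L →ₗ[K] L →ₗ[K] M) (hB : ∀ x, IsRegular K x → B x x = 0) (y : L) : B y y = 0 := by
  obtain ⟨x, hx⟩ := exists_isRegular K L
  have hfin := hx.finite_setOf_not_add_smul y
  obtain ⟨s, hs⟩ := (hfin.union (Set.finite_singleton 0)).exists_notMem
  obtain ⟨t, ht⟩ := (hfin.union (Set.toFinite {0, s})).exists_notMem
  simp only [Set.mem_union, Set.mem_ofPred_eq, Set.mem_singleton_iff, Set.mem_insert_iff, not_or,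
    not_not] at hs ht
  have key (r : K) (hr : IsRegular K (x + r • y)) (hr0 : r ≠ 0) :
      B x y + B y x + r • B y y = 0 := by
    have h := hB _ hr
    simp only [map_add, map_smul, LinearMap.add_apply, LinearMap.smul_apply, hB x hx] at h
    refine (smul_eq_zero.1 ?_).resolve_left hr0
    rw [← h]
    module
  have h : (t - s) • B y y = 0 := by
    rw [sub_smul, sub_eq_zero]
    exact add_left_cancel ((key t ht.1 ht.2.1).trans (key s hs.1 hs.2).symm)
  exact (smul_eq_zero.1 h).resolve_left (sub_ne_zero.2 ht.2.2)

end LieAlgebra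

namespace IsLocalAutomorphism

open LieAlgebra Polynomial LieModule

variable {K L : Type*} [Field K] [CharZero K] [LieRing L] [LieAlgebra K L] [FiniteDimensional K L]
  [IsKilling K L] {φ : L →ₗ[K] L}

section Cartan

variable {H : LieSubalgebra K L} [H.IsCartanSubalgebra] [IsTriangularizable K H L]

/-- A local automorphism fixing a Cartan subalgebra pointwise commutes with `(ad z) ^ 2` for
every `z` in that subalgebra. -/
lemma map_lie_lie_of_forall_apply_eq (hφ : IsLocalAutomorphism K L φ)
    (hH : ∀ z : H, φ z = z) (z : H) (y : L) : φ ⁅z, ⁅z, y⁆⁆ = ⁅z, ⁅z, φ y⁆⁆ := by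
  obtain ⟨x, hx, hx₀⟩ := IsKilling.exists_forall_weight_ne K L H
  have hy : y ∈ ⨆ α : Weight K H L, (rootSpace H α).toSubmodule := by
    rw [LieSubmodule.iSup_toSubmodule_eq_top.2 (iSup_genWeightSpace_eq_top' K H L)]
    trivial
  induction hy using Submodule.iSup_induction' with
  | mem α y hy =>
    have hlie (z : H) : ⁅z, y⁆ = α z • y := IsKilling.lie_eq_smul_of_mem_rootSpace hy z
    by_cases hα : α.IsZero
    · have hyH := hy
      rw [hα.eq, rootSpace_zero_eq] at hyH
      have hφy : φ y = y := hH ⟨y, hyH⟩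
      rw [hφy, hlie, lie_smul, hlie, map_smul, map_smul, hφy]
    · rw [hlie, lie_smul, hlie, smul_smul, map_smul]
      refine (IsKilling.lie_lie_eq_smul_of_forall_smul_lie_eq hx₀ hα (fun u ↦ ?_)
        (fun u ↦ ?_) z).symm
      · rw [← hH u, hφ.killingForm_apply]
        refine killingForm_apply_eq_zero_of_mem_rootSpace_of_add_ne_zero K L H (β := 0) hy ?_
          (by rwa [add_zero])
        rw [rootSpace_zero_eq]
        exact u.2
      · obtain ⟨e, he⟩ := IsKilling.exists_lieEquiv_coe_eq_sub hα hy
        obtain ⟨p, hp⟩ := IsKilling.exists_adTraceGradient_eq hx u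
        have h := lie_adTraceGradient p (φ (e x))
        have he' : e (adTraceGradient p x) = adTraceGradient p (e x) :=
          (of_lieEquiv e).map_adTraceGradient p (x : L)
        have hxu : ⁅(x : L), (u : L)⁆ = 0 := hp ▸ lie_adTraceGradient p (x : L)
        rw [← hφ.map_adTraceGradient, ← he', hp, he, he, map_sub, map_sub, map_smul, map_smul,
          hH, hH, sub_lie, lie_sub, lie_sub, lie_smul, smul_lie, smul_lie, lie_smul, lie_self,
          hxu, ← lie_skew (φ y)] at h
        change α u • ⁅(x : L), φ y⁆ = α x • ⁅(u : L), φ y⁆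
        rw [← sub_eq_zero, ← neg_eq_zero, ← h]
        module
  | zero => simp
  | add y z _ _ hy hz => simp only [map_add, lie_add, hy, hz]

lemma map_lie_lie_of_mem_cartan (hφ : IsLocalAutomorphism K L φ) (z : H) (y : L) :
    φ ⁅(z : L), ⁅(z : L), y⁆⁆ = ⁅φ z, ⁅φ z, φ y⁆⁆ := by
  obtain ⟨x, hx, -⟩ := IsKilling.exists_forall_weight_ne K L H
  obtain ⟨e, he⟩ := hφ x
  have hψ := (of_lieEquiv e.symm).comp hφ
  set ψ := (e.symm : L →ₗ[K] L) ∘ₗ φ with hψ_def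
  have hψx : ψ x = x := by simp [hψ_def, he]
  have hH (z : H) : ψ z = z := by
    obtain ⟨p, hp⟩ := IsKilling.exists_adTraceGradient_eq hx z
    rw [← hp, hψ.map_adTraceGradient, hψx]
  have heψ (y : L) : φ y = e (ψ y) := by simp [hψ_def]
  have h := hψ.map_lie_lie_of_forall_apply_eq hH z y
  simp only [heψ, hH, ← LieEquiv.map_lie]
  exact congrArg e h

end Cartan

lemma map_lie_lie_self [IsAlgClosed K] (hφ : IsLocalAutomorphism K L φ) (x y : L) :
    φ ⁅x, ⁅x, y⁆⁆ = ⁅φ x, ⁅φ x, φ y⁆⁆ := by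
  let B : L →ₗ[K] L →ₗ[K] L := LinearMap.mk₂ K
    (fun x z ↦ φ ⁅x, ⁅z, y⁆⁆ - ⁅φ x, ⁅φ z, φ y⁆⁆)
    (fun _ _ _ ↦ by simp only [add_lie, map_add]; abel)
    (fun _ _ _ ↦ by simp only [smul_lie, map_smul, smul_sub])
    (fun _ _ _ ↦ by simp only [add_lie, lie_add, map_add]; abel)
    (fun _ _ _ ↦ by simp only [smul_lie, lie_smul, map_smul, smul_sub])
  refine sub_eq_zero.1 (apply_self_eq_zero_of_forall_isRegular B (fun x hx ↦ ?_) x)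
  have := hx.isCartanSubalgebra_engel
  exact sub_eq_zero.2 (hφ.map_lie_lie_of_mem_cartan (H := LieSubalgebra.engel K x)
    ⟨x, LieSubalgebra.self_mem_engel K x⟩ y)

end IsLocalAutomorphism

theorem localAutomorphism_eq_pm_automorphism
    (K L : Type*) [Field K] [IsAlgClosed K] [CharZero K]
    [LieRing L] [LieAlgebra K L] [FiniteDimensional K L] [LieAlgebra.IsSimple K L]
    (φ : L →ₗ[K] L) (hφ : IsLocalAutomorphism K L φ) :
    ∃ β : L ≃ₗ⁅K⁆ L, φ = (β : L →ₗ[K] L) ∨ φ = -(β : L →ₗ[K] L) := by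
  exact LieAlgebra.exists_eq_pm_of_lie_lie hφ.bijective
    (LieAlgebra.lie_lie_of_lie_self_lie hφ.map_lie_lie_self)
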